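/- Let n_1, n_2 ≥ 1 and suppose the type II multiple orthogonal polynomials P_{n_1,n_2} and P_{n_1+1,n_2} and the type I multiple orthogonal functions Q_{n_1,n_2−1} and Q_{n_1,n_2} exist, and that h^{(1)}_{n_1−1,n_2−1}, h^{(1)}_{n_1−1,n_2} and h^{(2)}_{n_1,n_2−1} are nonzero (with the corresponding P's existing). Then: (i) ∫ x P_{n_1,n_2}(x) Q_{n_1,n_2−1}(x) e^{−V(x)} dx = h^{(1)}_{n_1,n_2} / h^{(1)}_{n_1−1,n_2−1}; (ii) ∫ x P_{n_1,n_2}(x) Q_{n_1,n_2}(x) e^{−V(x)} dx = h^{(1)}_{n_1,n_2} / h^{(1)}_{n_1−1,n_2} + h^{(2)}_{n_1,n_2} / h^{(2)}_{n_1,n_2−1}; (iii) ∫ x P_{n_1+1,n_2}(x) Q_{n_1,n_2}(x) e^{−V(x)} dx = h^{(2)}_{n_1+1,n_2} / h^{(2)}_{n_1,n_2−1}. -/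

import Mathlib

open MeasureTheory

/-- The weight `w(x) = e^{-(V(x) - a x)}`. -/
noncomputable def wgt (V : ℝ → ℝ) (a x : ℝ) : ℝ := Real.exp (-(V x - a * x))

/-- The function `A(x) e^{a₁ x} + B(x) e^{a₂ x}` built from two polynomials. -/
noncomputable def typeIFun (a₁ a₂ : ℝ) (A B : Polynomial ℝ) (x : ℝ) : ℝ :=
  Polynomial.eval x A * Real.exp (a₁ * x) + Polynomial.eval x B * Real.exp (a₂ * x)

/-- `P` is the type II multiple orthogonal polynomial `P_{k₁,k₂}`: monic of degree
`k₁ + k₂`, with `kⱼ` orthogonality conditions with respect to `wⱼ`, `j = 1, 2`. -/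
structure IsTypeII (V : ℝ → ℝ) (a₁ a₂ : ℝ) (k₁ k₂ : ℕ) (P : Polynomial ℝ) : Prop where
  monic : P.Monic
  natDeg : P.natDegree = k₁ + k₂
  orth₁ : ∀ i : ℕ, i < k₁ → (∫ x : ℝ, Polynomial.eval x P * x ^ i * wgt V a₁ x) = 0
  orth₂ : ∀ i : ℕ, i < k₂ → (∫ x : ℝ, Polynomial.eval x P * x ^ i * wgt V a₂ x) = 0

/-- `(A, B)` gives the type I multiple orthogonal function
`Q_{k₁,k₂}(x) = A(x) e^{a₁ x} + B(x) e^{a₂ x}`, where `deg A ≤ k₁ - 1`,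
`deg B ≤ k₂ - 1`, `∫ x^j Q(x) e^{-V(x)} dx = 0` for `j = 0, …, k₁ + k₂ - 2`
and `= 1` for `j = k₁ + k₂ - 1`. -/
structure IsTypeI (V : ℝ → ℝ) (a₁ a₂ : ℝ) (k₁ k₂ : ℕ) (A B : Polynomial ℝ) : Prop where
  degA : A.degree < (k₁ : WithBot ℕ)
  degB : B.degree < (k₂ : WithBot ℕ)
  orth : ∀ j : ℕ, j + 1 < k₁ + k₂ →
    (∫ x : ℝ, x ^ j * typeIFun a₁ a₂ A B x * Real.exp (-(V x))) = 0
  norm : (∫ x : ℝ, x ^ (k₁ + k₂ - 1) * typeIFun a₁ a₂ A B x * Real.exp (-(V x))) = 1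

/-- The number `h^{(j)}_{k₁,k₂} = ∫ P_{k₁,k₂}(x) x^{k_j} w_j(x) dx`; here `a = a_j`
and `k = k_j`, and `P` should be the polynomial `P_{k₁,k₂}`. -/
noncomputable def hNum (V : ℝ → ℝ) (a : ℝ) (k : ℕ) (P : Polynomial ℝ) : ℝ :=
  ∫ x : ℝ, Polynomial.eval x P * x ^ k * wgt V a x

/-- Integrating a polynomial of degree at most `k` against a function whose first `k` moments
vanish only sees the coefficient of `x ^ k`. -/
lemma integral_eval_mul_of_moments_eq_zero {f : ℝ → ℝ}
    (hf : ∀ i : ℕ, Integrable (fun x : ℝ => x ^ i * f x)) {k : ℕ}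
    (hzero : ∀ i < k, (∫ x : ℝ, x ^ i * f x) = 0)
    {R : Polynomial ℝ} (hR : R.natDegree ≤ k) :
    (∫ x : ℝ, R.eval x * f x) = R.coeff k * ∫ x : ℝ, x ^ k * f x := by
  have hsum : ∀ x : ℝ, R.eval x * f x =
      ∑ i ∈ Finset.range (k + 1), R.coeff i * (x ^ i * f x) := fun x => by
    rw [Polynomial.eval_eq_sum_range' (Nat.lt_succ_of_le hR), Finset.sum_mul]
    exact Finset.sum_congr rfl fun i _ => mul_assoc _ _ _
  simp_rw [hsum]
  rw [integral_finsetSum _ fun i _ => (hf i).const_mul _]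
  simp_rw [integral_const_mul]
  rw [Finset.sum_range_succ, Finset.sum_eq_zero, zero_add]
  intro i hi
  rw [hzero i (Finset.mem_range.mp hi), mul_zero]

/-- Every polynomial is integrable against the weight `w(x) = e^{-(V(x) - a x)}`. -/
lemma integrable_eval_mul_wgt {V : ℝ → ℝ} (hV : Continuous V)
    (hVint : ∀ (a : ℝ) (k : ℕ),
      Integrable (fun x : ℝ => |x| ^ k * Real.exp (-(V x - a * x))))
    (a : ℝ) (R : Polynomial ℝ) : Integrable (fun x : ℝ => R.eval x * wgt V a x) := by
  have hmono : ∀ k : ℕ, Integrable (fun x : ℝ => x ^ k * wgt V a x) := fun k => by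
    refine (hVint a k).mono (by unfold wgt; fun_prop) (.of_forall fun x => ?_)
    simp [wgt]
  have hsum : (fun x : ℝ => R.eval x * wgt V a x) = fun x =>
      ∑ i ∈ Finset.range (R.natDegree + 1), R.coeff i * (x ^ i * wgt V a x) := by
    funext x
    rw [Polynomial.eval_eq_sum_range, Finset.sum_mul]
    exact Finset.sum_congr rfl fun i _ => mul_assoc _ _ _
  rw [hsum]
  exact integrable_finsetSum _ fun i _ => (hmono i).const_mul _

lemma typeIFun_mul_exp_neg (V : ℝ → ℝ) (a₁ a₂ : ℝ) (A B : Polynomial ℝ) (x : ℝ) :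
    typeIFun a₁ a₂ A B x * Real.exp (-(V x)) =
      A.eval x * wgt V a₁ x + B.eval x * wgt V a₂ x := by
  have hw : ∀ a : ℝ, wgt V a x = Real.exp (a * x) * Real.exp (-(V x)) := fun a => by
    rw [wgt, ← Real.exp_add]
    congr 1
    ring
  rw [typeIFun, hw, hw]
  ring

/-- Pairing a polynomial with a type I function splits into the two weights. -/
lemma integral_eval_mul_typeIFun
    {V : ℝ → ℝ} (hV : Continuous V)
    (hVint : ∀ (a : ℝ) (k : ℕ),
      Integrable (fun x : ℝ => |x| ^ k * Real.exp (-(V x - a * x))))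
    {a₁ a₂ : ℝ} (R A B : Polynomial ℝ) :
    (∫ x : ℝ, R.eval x * (typeIFun a₁ a₂ A B x * Real.exp (-(V x)))) =
      (∫ x : ℝ, (R * A).eval x * wgt V a₁ x) + ∫ x : ℝ, (R * B).eval x * wgt V a₂ x := by
  rw [← integral_add (integrable_eval_mul_wgt hV hVint a₁ _)
    (integrable_eval_mul_wgt hV hVint a₂ _)]
  refine integral_congr_ae (.of_forall fun x => ?_)
  simp only [typeIFun_mul_exp_neg, Polynomial.eval_mul]
  ring

/-- Only the coefficient of `x ^ k` survives when a polynomial of degree at most `k` is paired with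
a polynomial orthogonal to all lower powers. -/
lemma integral_mul_eq_coeff_mul_hNum
    {V : ℝ → ℝ} (hV : Continuous V)
    (hVint : ∀ (a : ℝ) (k : ℕ),
      Integrable (fun x : ℝ => |x| ^ k * Real.exp (-(V x - a * x))))
    {a : ℝ} {k : ℕ} {P S : Polynomial ℝ}
    (hP : ∀ i : ℕ, i < k → (∫ x : ℝ, P.eval x * x ^ i * wgt V a x) = 0)
    (hS : S.natDegree ≤ k) :
    (∫ x : ℝ, (P * S).eval x * wgt V a x) = S.coeff k * hNum V a k P := by
  have hcomm : ∀ (i : ℕ) (x : ℝ),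
      x ^ i * (P.eval x * wgt V a x) = P.eval x * x ^ i * wgt V a x := fun i x => by ring
  have key := integral_eval_mul_of_moments_eq_zero (f := fun x => P.eval x * wgt V a x)
    (k := k) (R := S)
    (fun i => by
      have h := integrable_eval_mul_wgt hV hVint a (Polynomial.X ^ i * P)
      simpa [mul_assoc] using h)
    (fun i hi => by simp_rw [hcomm]; exact hP i hi) hS
  simp_rw [hcomm] at key
  rw [hNum, ← key]
  refine integral_congr_ae (.of_forall fun x => ?_)
  simp only [Polynomial.eval_mul]
  ring

/-- A monic polynomial of degree `k₁ + k₂ - 1` pairs to `1` with the type I function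
`Q_{k₁,k₂}`. -/
lemma IsTypeI.integral_monic
    {V : ℝ → ℝ} (hV : Continuous V)
    (hVint : ∀ (a : ℝ) (k : ℕ),
      Integrable (fun x : ℝ => |x| ^ k * Real.exp (-(V x - a * x))))
    {a₁ a₂ : ℝ} {k₁ k₂ : ℕ} {A B P : Polynomial ℝ}
    (hQ : IsTypeI V a₁ a₂ k₁ k₂ A B) (hP : P.Monic) (hdeg : P.natDegree = k₁ + k₂ - 1) :
    (∫ x : ℝ, P.eval x * (typeIFun a₁ a₂ A B x * Real.exp (-(V x)))) = 1 := by
  have hQint : ∀ i : ℕ, Integrable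
      (fun x : ℝ => x ^ i * (typeIFun a₁ a₂ A B x * Real.exp (-(V x)))) := fun i => by
    have h := (integrable_eval_mul_wgt hV hVint a₁ (Polynomial.X ^ i * A)).add
      (integrable_eval_mul_wgt hV hVint a₂ (Polynomial.X ^ i * B))
    refine h.congr (.of_forall fun x => ?_)
    simp only [typeIFun_mul_exp_neg, Pi.add_apply, Polynomial.eval_mul, Polynomial.eval_pow,
      Polynomial.eval_X]
    ring
  rw [integral_eval_mul_of_moments_eq_zero hQint (k := k₁ + k₂ - 1)
    (fun i hi => by simpa only [mul_assoc] using hQ.orth i (by omega)) hdeg.le, ← hdeg,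
    hP.coeff_natDegree, hdeg, one_mul]
  simpa only [mul_assoc] using hQ.norm

/-- A polynomial orthogonal to the powers below `k` is orthogonal to every polynomial of degree
less than `k`. -/
lemma integral_mul_eq_zero_of_degree_lt
    {V : ℝ → ℝ} (hV : Continuous V)
    (hVint : ∀ (a : ℝ) (k : ℕ),
      Integrable (fun x : ℝ => |x| ^ k * Real.exp (-(V x - a * x))))
    {a : ℝ} {k : ℕ} {P S : Polynomial ℝ}
    (hP : ∀ i : ℕ, i < k → (∫ x : ℝ, P.eval x * x ^ i * wgt V a x) = 0)
    (hS : S.degree < (k : WithBot ℕ)) :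
    (∫ x : ℝ, (P * S).eval x * wgt V a x) = 0 := by
  rw [integral_mul_eq_coeff_mul_hNum hV hVint hP
    (Polynomial.natDegree_le_iff_degree_le.mpr hS.le),
    Polynomial.coeff_eq_zero_of_degree_lt hS, zero_mul]

/-- The top coefficient of the first component of `Q_{k₁+1,k₂}` is the inverse of
`h^{(1)}_{k₁,k₂}`. -/
lemma IsTypeI.coeff_fst_mul_hNum
    {V : ℝ → ℝ} (hV : Continuous V)
    (hVint : ∀ (a : ℝ) (k : ℕ),
      Integrable (fun x : ℝ => |x| ^ k * Real.exp (-(V x - a * x))))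
    {a₁ a₂ : ℝ} {k₁ k₂ : ℕ} {A B P : Polynomial ℝ}
    (hQ : IsTypeI V a₁ a₂ (k₁ + 1) k₂ A B) (hP : IsTypeII V a₁ a₂ k₁ k₂ P) :
    A.coeff k₁ * hNum V a₁ k₁ P = 1 := by
  rw [← hQ.integral_monic hV hVint hP.monic (by rw [hP.natDeg]; omega),
    integral_eval_mul_typeIFun hV hVint,
    integral_mul_eq_zero_of_degree_lt hV hVint hP.orth₂ hQ.degB,
    add_zero, integral_mul_eq_coeff_mul_hNum hV hVint hP.orth₁
      (Polynomial.natDegree_le_iff_degree_le.mpr (Order.lt_succ_iff.mp hQ.degA))]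

/-- The top coefficient of the second component of `Q_{k₁,k₂+1}` is the inverse of
`h^{(2)}_{k₁,k₂}`. -/
lemma IsTypeI.coeff_snd_mul_hNum
    {V : ℝ → ℝ} (hV : Continuous V)
    (hVint : ∀ (a : ℝ) (k : ℕ),
      Integrable (fun x : ℝ => |x| ^ k * Real.exp (-(V x - a * x))))
    {a₁ a₂ : ℝ} {k₁ k₂ : ℕ} {A B P : Polynomial ℝ}
    (hQ : IsTypeI V a₁ a₂ k₁ (k₂ + 1) A B) (hP : IsTypeII V a₁ a₂ k₁ k₂ P) :
    B.coeff k₂ * hNum V a₂ k₂ P = 1 := by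
  rw [← hQ.integral_monic hV hVint hP.monic (by rw [hP.natDeg]; omega),
    integral_eval_mul_typeIFun hV hVint,
    integral_mul_eq_zero_of_degree_lt hV hVint hP.orth₁ hQ.degA,
    zero_add, integral_mul_eq_coeff_mul_hNum hV hVint hP.orth₂
      (Polynomial.natDegree_le_iff_degree_le.mpr (Order.lt_succ_iff.mp hQ.degB))]

/-- The pairing of `x P(x)` with a type I function, split into the two weights. -/
lemma integral_X_mul_typeIFun
    {V : ℝ → ℝ} (hV : Continuous V)
    (hVint : ∀ (a : ℝ) (k : ℕ),
      Integrable (fun x : ℝ => |x| ^ k * Real.exp (-(V x - a * x))))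
    {a₁ a₂ : ℝ} (P A B : Polynomial ℝ) :
    (∫ x : ℝ, x * P.eval x * typeIFun a₁ a₂ A B x * Real.exp (-(V x))) =
      (∫ x : ℝ, (P * (Polynomial.X * A)).eval x * wgt V a₁ x) +
        ∫ x : ℝ, (P * (Polynomial.X * B)).eval x * wgt V a₂ x := by
  rw [← mul_assoc, ← mul_assoc, ← integral_eval_mul_typeIFun hV hVint]
  refine integral_congr_ae (.of_forall fun x => ?_)
  simp only [Polynomial.eval_mul, Polynomial.eval_X]
  ring

lemma degree_X_mul_lt {S : Polynomial ℝ} {k : ℕ} (hS : S.degree < (k : WithBot ℕ)) :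
    (Polynomial.X * S).degree < ((k + 1 : ℕ) : WithBot ℕ) := by
  rw [Polynomial.degree_lt_iff_coeff_zero] at hS ⊢
  intro m hm
  obtain ⟨m, rfl⟩ := Nat.exists_eq_add_of_le' (Nat.one_le_of_lt hm)
  rw [Polynomial.coeff_X_mul]
  exact hS m (by omega)

theorem statement_18 (V : ℝ → ℝ) (hV : Continuous V)
    (hVint : ∀ (a : ℝ) (k : ℕ),
      Integrable (fun x : ℝ => |x| ^ k * Real.exp (-(V x - a * x))))
    (a₁ a₂ : ℝ) (ha : a₁ ≠ a₂)
    (n₁ n₂ : ℕ) (hn₁ : 1 ≤ n₁) (hn₂ : 1 ≤ n₂)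
    -- the type II polynomials `P_{n₁,n₂}` and `P_{n₁+1,n₂}`
    (Pnn : Polynomial ℝ) (hPnn : IsTypeII V a₁ a₂ n₁ n₂ Pnn)
    (Ppn : Polynomial ℝ) (hPpn : IsTypeII V a₁ a₂ (n₁ + 1) n₂ Ppn)
    -- the type I functions `Q_{n₁,n₂-1}` and `Q_{n₁,n₂}`
    (Aq Bq : Polynomial ℝ) (hQq : IsTypeI V a₁ a₂ n₁ (n₂ - 1) Aq Bq)
    (An Bn : Polynomial ℝ) (hQn : IsTypeI V a₁ a₂ n₁ n₂ An Bn)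
    -- the type II polynomials `P_{n₁-1,n₂-1}`, `P_{n₁-1,n₂}`, `P_{n₁,n₂-1}`,
    -- with the corresponding `h`-numbers nonzero
    (Pmm : Polynomial ℝ) (hPmm : IsTypeII V a₁ a₂ (n₁ - 1) (n₂ - 1) Pmm)
    (Pmn : Polynomial ℝ) (hPmn : IsTypeII V a₁ a₂ (n₁ - 1) n₂ Pmn)
    (Pnm : Polynomial ℝ) (hPnm : IsTypeII V a₁ a₂ n₁ (n₂ - 1) Pnm)
    (hmm : hNum V a₁ (n₁ - 1) Pmm ≠ 0)
    (hmn : hNum V a₁ (n₁ - 1) Pmn ≠ 0)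
    (hnm : hNum V a₂ (n₂ - 1) Pnm ≠ 0) :
    (∫ x : ℝ, x * Polynomial.eval x Pnn * typeIFun a₁ a₂ Aq Bq x * Real.exp (-(V x))) =
      hNum V a₁ n₁ Pnn / hNum V a₁ (n₁ - 1) Pmm ∧
    (∫ x : ℝ, x * Polynomial.eval x Pnn * typeIFun a₁ a₂ An Bn x * Real.exp (-(V x))) =
      hNum V a₁ n₁ Pnn / hNum V a₁ (n₁ - 1) Pmn +
        hNum V a₂ n₂ Pnn / hNum V a₂ (n₂ - 1) Pnm ∧
    (∫ x : ℝ, x * Polynomial.eval x Ppn * typeIFun a₁ a₂ An Bn x * Real.exp (-(V x))) =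
      hNum V a₂ n₂ Ppn / hNum V a₂ (n₂ - 1) Pnm := by
  obtain ⟨m₁, rfl⟩ := Nat.exists_eq_add_of_le' hn₁
  obtain ⟨m₂, rfl⟩ := Nat.exists_eq_add_of_le' hn₂
  simp only [Nat.add_sub_cancel] at *
  have natDegree_le : ∀ {S : Polynomial ℝ} {k : ℕ}, S.degree < (k : WithBot ℕ) →
      (Polynomial.X * S).natDegree ≤ k := fun hS =>
    Polynomial.natDegree_le_iff_degree_le.mpr (Order.lt_succ_iff.mp (degree_X_mul_lt hS))
  have hAq := eq_one_div_of_mul_eq_one_left (hQq.coeff_fst_mul_hNum hV hVint hPmm)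
  have hAn := eq_one_div_of_mul_eq_one_left (hQn.coeff_fst_mul_hNum hV hVint hPmn)
  have hBn := eq_one_div_of_mul_eq_one_left (hQn.coeff_snd_mul_hNum hV hVint hPnm)
  refine ⟨?_, ?_, ?_⟩ <;> rw [integral_X_mul_typeIFun hV hVint]
  · rw [integral_mul_eq_zero_of_degree_lt hV hVint hPnn.orth₂ (degree_X_mul_lt hQq.degB),
      integral_mul_eq_coeff_mul_hNum hV hVint hPnn.orth₁ (natDegree_le hQq.degA),
      Polynomial.coeff_X_mul, hAq]
    ring
  · rw [integral_mul_eq_coeff_mul_hNum hV hVint hPnn.orth₁ (natDegree_le hQn.degA),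
      integral_mul_eq_coeff_mul_hNum hV hVint hPnn.orth₂ (natDegree_le hQn.degB),
      Polynomial.coeff_X_mul, Polynomial.coeff_X_mul, hAn, hBn]
    ring
  · rw [integral_mul_eq_zero_of_degree_lt hV hVint hPpn.orth₁ (degree_X_mul_lt hQn.degA),
      integral_mul_eq_coeff_mul_hNum hV hVint hPpn.orth₂ (natDegree_le hQn.degB),
      Polynomial.coeff_X_mul, hBn]
    ring
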